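/- arXiv:1110.3458 — 2 statements merged into one kernel-verified Lean document; each statement's English description precedes it below -/
import Mathlib

section
/- Fix an integer p ≥ 2 and define the reduced operators P̄_{np}^{(2)} = ∑_{i+j=np, p∤i, p∤j} : P_i P_j : acting on the polynomial ring in the variables {t_i : p ∤ i}. Then for m, n ∈ {−1, 0, 1, …}, the reduced quadratic currents satisfy the same commutation relations as the unreduced ones: [½ P̄_{np}^{(2)}, ½ P̄_{mp}^{(2)}] = ½ (np − mp) P̄_{(n+m)p}^{(2)} + (1/12)((np)³ − np) δ_{n+m,0}. -/
/-!
Statement 6: Fix `p ≥ 2` and define the reduced operators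
`P̄_{np}^{(2)} = ∑_{i+j=np, p∤i, p∤j} :P_i P_j:` (acting on polynomials in the
variables `t_i` with `p ∤ i`).  For `m, n ∈ {-1, 0, 1, …}` the reduced quadratic
currents satisfy the same commutation relations as the unreduced ones:
`[½P̄_{np}^{(2)}, ½P̄_{mp}^{(2)}] = ½(np - mp) P̄_{(n+m)p}^{(2)} + (1/12)((np)³ - np) δ_{n+m,0}`.

`ℂ[t₁, t₂, …]` is modelled as `MvPolynomial ℤ ℂ` (variable `i ≥ 1` is `t_i`);
the reduced operators only involve the variables `t_i` with `p ∤ i`.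
-/

open MvPolynomial

noncomputable section

def P (i : ℤ) : MvPolynomial ℤ ℂ → MvPolynomial ℤ ℂ := fun f =>
  if 0 < i then pderiv i f
  else if i < 0 then (i.natAbs : ℂ) • (X (-i) * f)
  else 0

def NO (i j : ℤ) : MvPolynomial ℤ ℂ → MvPolynomial ℤ ℂ := fun f =>
  if i ≤ j then P i (P j f) else P j (P i f)

/-- The reduced quadratic current `P̄_n^{(2)}`. -/
def Pbar (p : ℕ) (n : ℤ) : MvPolynomial ℤ ℂ → MvPolynomial ℤ ℂ := fun f =>
  ∑ᶠ i : ℤ, if ¬ ((p : ℤ) ∣ i) ∧ ¬ ((p : ℤ) ∣ (n - i)) then NO i (n - i) f else 0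

/-- `P i` as a linear endomorphism. -/
def linP (i : ℤ) : Module.End ℂ (MvPolynomial ℤ ℂ) where
  toFun := P i
  map_add' f g := by
    unfold P; split_ifs <;> simp [mul_add]
  map_smul' c f := by
    unfold P
    split_ifs
    · simp
    · simp [smul_comm c]
    · simp

lemma P_eq_linP (i : ℤ) (f : MvPolynomial ℤ ℂ) : P i f = linP i f := rfl

lemma linP_of_pos {i : ℤ} (hi : 0 < i) (f : MvPolynomial ℤ ℂ) : linP i f = pderiv i f :=
  if_pos hi

lemma linP_of_neg {i : ℤ} (hi : i < 0) (f : MvPolynomial ℤ ℂ) :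
    linP i f = (-i : ℂ) • (X (-i) * f) := by
  have h : ((i.natAbs : ℤ) : ℂ) = -i := by
    rw [Int.ofNat_natAbs_of_nonpos hi.le]; push_cast; rfl
  rw [← h, ← P_eq_linP, P, if_neg hi.le.not_gt, if_pos hi]
  simp

lemma linP_zero : linP 0 = 0 := by
  refine LinearMap.ext fun f => ?_
  rw [← P_eq_linP, P, if_neg (lt_irrefl 0), if_neg (lt_irrefl 0), LinearMap.zero_apply]

lemma linP_one_of_nonneg {i : ℤ} (hi : 0 ≤ i) : linP i 1 = 0 := by
  rcases hi.eq_or_lt with rfl | h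
  · simp [linP_zero]
  · simp [linP_of_pos h]

/-- The Heisenberg relation `[P_i, P_j] = i δ_{i+j,0}`. -/
lemma linP_linP (i j : ℤ) (f : MvPolynomial ℤ ℂ) :
    linP i (linP j f) = linP j (linP i f) + (if i + j = 0 then (i : ℂ) else 0) • f := by
  rcases lt_trichotomy i 0 with hi | rfl | hi
  · rcases lt_trichotomy j 0 with hj | rfl | hj
    · rw [if_neg (by omega)]
      simp only [linP_of_neg hi, linP_of_neg hj, mul_smul_comm, zero_smul, add_zero]
      rw [smul_comm, mul_left_comm]
    · simp [linP_zero, hi.ne]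
    · simp only [linP_of_neg hi, linP_of_pos hj, Derivation.map_smul, Derivation.leibniz,
        smul_eq_mul, pderiv_X, Pi.single_apply]
      by_cases h : i + j = 0
      · rw [if_pos h, if_pos (by omega)]
        simp only [smul_add, mul_one, neg_smul]; abel
      · rw [if_neg h, if_neg (by omega)]
        simp
  · simp [linP_zero]
  · rcases lt_trichotomy j 0 with hj | rfl | hj
    · simp only [linP_of_neg hj, linP_of_pos hi, Derivation.map_smul, Derivation.leibniz,
        smul_eq_mul, pderiv_X, Pi.single_apply]
      by_cases h : i + j = 0
      · obtain rfl : j = -i := by omega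
        simp
      · rw [if_neg h, if_neg (by omega)]
        simp
    · simp [linP_zero, hi.ne']
    · rw [if_neg (by omega)]
      simp only [linP_of_pos hi, linP_of_pos hj, zero_smul, add_zero]
      have h : ⁅(pderiv i : Derivation ℂ (MvPolynomial ℤ ℂ) (MvPolynomial ℤ ℂ)),
          (pderiv j : Derivation ℂ (MvPolynomial ℤ ℂ) (MvPolynomial ℤ ℂ))⁆ = 0 := by
        refine derivation_ext fun k => ?_
        simp [Derivation.commutator_apply, pderiv_X, Pi.single_apply, apply_ite]
      simpa [Derivation.commutator_apply, sub_eq_zero] using Derivation.congr_fun h f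

/-- `NO i j` as a linear endomorphism. -/
def linNO (i j : ℤ) : Module.End ℂ (MvPolynomial ℤ ℂ) :=
  if i ≤ j then linP i * linP j else linP j * linP i

lemma NO_eq_linNO (i j : ℤ) (f : MvPolynomial ℤ ℂ) : NO i j f = linNO i j f := by
  unfold NO linNO; split_ifs <;> rfl

lemma linNO_linP (i j k : ℤ) (f : MvPolynomial ℤ ℂ) :
    linNO i j (linP k f) = linP k (linNO i j f)
      + ((if i = -k then (-k : ℂ) • linP j f else 0)
        + (if j = -k then (-k : ℂ) • linP i f else 0)) := by
  have key (a b : ℤ) : linP a (linP b (linP k f)) = linP k (linP a (linP b f))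
      + ((if a = -k then (-k : ℂ) • linP b f else 0)
        + (if b = -k then (-k : ℂ) • linP a f else 0)) := by
    rw [linP_linP b k, map_add, map_smul, linP_linP a k, add_assoc]
    congr 2
    · by_cases h : a = -k
      · subst h; simp
      · rw [if_neg h, if_neg (by omega), zero_smul]
    · by_cases h : b = -k
      · subst h; simp
      · rw [if_neg h, if_neg (by omega), zero_smul]
  unfold linNO
  split_ifs with hij
  all_goals simp only [Module.End.mul_apply, key]; simp_all [add_comm]

/-- Normally ordered products annihilate polynomials not involving the larger index. -/
lemma linNO_eq_zero {i j : ℤ} {f : MvPolynomial ℤ ℂ} {M : ℤ} (hM : 0 ≤ M)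
    (hf : ∀ k ∈ f.vars, k ≤ M) (h : M < i ∨ M < j) : linNO i j f = 0 := by
  have hP (k : ℤ) (hk : M < k) : linP k f = 0 := by
    rw [linP_of_pos (by omega)]
    exact pderiv_eq_zero_of_notMem_vars fun hmem => (hf k hmem).not_gt hk
  unfold linNO
  split_ifs with hij <;> rw [Module.End.mul_apply, hP _ (by omega), map_zero]

/-- The summands of `Pbar`. -/
def pbarTerm (p : ℕ) (n i : ℤ) : Module.End ℂ (MvPolynomial ℤ ℂ) :=
  if ¬ ((p : ℤ) ∣ i) ∧ ¬ ((p : ℤ) ∣ (n - i)) then linNO i (n - i) else 0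

lemma Pbar_eq_finsum (p : ℕ) (n : ℤ) (f : MvPolynomial ℤ ℂ) :
    Pbar p n f = ∑ᶠ i, pbarTerm p n i f := by
  unfold Pbar pbarTerm
  congr! 2 with i
  split_ifs
  · exact NO_eq_linNO _ _ _
  · rfl

lemma pbarTerm_support_finite (p : ℕ) (n : ℤ) (f : MvPolynomial ℤ ℂ) :
    (Function.support fun i => pbarTerm p n i f).Finite := by
  obtain ⟨M, hM⟩ := f.vars.exists_le
  refine (Set.finite_Icc (n - max M 0) (max M 0)).subset fun i hi => ?_
  by_contra hout
  apply hi
  simp only [pbarTerm]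
  split_ifs
  · refine linNO_eq_zero (le_max_right M 0) (fun k hk => (hM k hk).trans (le_max_left _ _)) ?_
    simp only [Set.mem_Icc, not_and_or, not_le] at hout
    omega
  · rfl

/-- Half of `Pbar` as a linear endomorphism. -/
def current (p : ℕ) (n : ℤ) : Module.End ℂ (MvPolynomial ℤ ℂ) where
  toFun f := (1 / 2 : ℂ) • Pbar p n f
  map_add' f g := by
    simp only [Pbar_eq_finsum, map_add]
    rw [finsum_add_distrib (pbarTerm_support_finite p n f) (pbarTerm_support_finite p n g),
      smul_add]
  map_smul' c f := by
    simp only [Pbar_eq_finsum, map_smul, RingHom.id_apply]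
    rw [← smul_finsum, smul_comm]

lemma current_apply (p : ℕ) (n : ℤ) (f : MvPolynomial ℤ ℂ) :
    current p n f = (1 / 2 : ℂ) • ∑ᶠ i, pbarTerm p n i f := by
  rw [← Pbar_eq_finsum]; rfl

/-- `[½ P̄_n, P_k] = -k P_{n+k}`. -/
lemma current_linP {p : ℕ} {n k : ℤ} (hn : (p : ℤ) ∣ n) (hk : ¬ (p : ℤ) ∣ k)
    (f : MvPolynomial ℤ ℂ) :
    current p n (linP k f) = linP k (current p n f) + (-k : ℂ) • linP (n + k) f := by
  have hterm (i : ℤ) : pbarTerm p n i (linP k f) = linP k (pbarTerm p n i f)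
      + ((if i = -k then (-k : ℂ) • linP (n + k) f else 0)
        + (if i = n + k then (-k : ℂ) • linP (n + k) f else 0)) := by
    unfold pbarTerm
    split_ifs with h
    all_goals first
      | (rw [linNO_linP]; congr 2
         · grind
         · grind)
      | skip
    all_goals first
      | simp; done
      | skip
    all_goals
      exfalso; apply h
      subst_vars
      refine ⟨?_, ?_⟩ <;> simpa [dvd_add_right hn] using hk
  have hfin (a : ℤ) (g : MvPolynomial ℤ ℂ) :
      (Function.support fun i => if i = a then g else 0).Finite := by
    refine (Set.finite_singleton a).subset fun i hi => ?_
    by_contra h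
    exact hi (if_neg h)
  have hsum (a : ℤ) (g : MvPolynomial ℤ ℂ) : ∑ᶠ i, (if i = a then g else 0) = g := by
    rw [finsum_eq_single _ a fun i hi => if_neg hi, if_pos rfl]
  have hs := pbarTerm_support_finite p n f
  simp only [current_apply, hterm, map_smul]
  rw [finsum_add_distrib, finsum_add_distrib (hfin _ _) (hfin _ _), hsum, hsum,
    map_finsum (linP k) hs, smul_add, ← two_smul ℂ ((-k : ℂ) • linP (n + k) f), smul_smul]
  · norm_num
  · exact hs.subset fun i hi h => hi (by simp only at h ⊢; rw [h, map_zero])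
  · exact ((hfin _ _).union (hfin _ _)).subset (Function.support_add _ _)

lemma linP_X_mul {i k : ℤ} (h : i ≠ k) (f : MvPolynomial ℤ ℂ) :
    linP i (X k * f) = X k * linP i f := by
  rcases lt_trichotomy i 0 with hi | rfl | hi
  · simp only [linP_of_neg hi, mul_smul_comm, mul_left_comm]
  · simp [linP_zero]
  · simp [linP_of_pos hi, pderiv_X, h.symm]

lemma linP_X_mul_of_nonpos {i k : ℤ} (hk : k ≤ 0) (f : MvPolynomial ℤ ℂ) :
    linP i (X k * f) = X k * linP i f := by
  by_cases h : i = k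
  · subst h
    rcases hk.eq_or_lt with rfl | hi
    · simp [linP_zero]
    · simp only [linP_of_neg hi, mul_smul_comm, mul_left_comm]
  · exact linP_X_mul h f

lemma current_X_mul {p : ℕ} (n : ℤ) {k : ℤ} (hk : k ≤ 0 ∨ (p : ℤ) ∣ k)
    (f : MvPolynomial ℤ ℂ) : current p n (X k * f) = X k * current p n f := by
  have hP (i : ℤ) (hi : ¬ (p : ℤ) ∣ i) (g : MvPolynomial ℤ ℂ) :
      linP i (X k * g) = X k * linP i g := by
    rcases hk with hk | hk
    · exact linP_X_mul_of_nonpos hk g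
    · exact linP_X_mul (by rintro rfl; exact hi hk) g
  have hterm (i : ℤ) : pbarTerm p n i (X k * f) = X k * pbarTerm p n i f := by
    unfold pbarTerm
    split_ifs with h
    · unfold linNO
      split_ifs <;> simp only [Module.End.mul_apply, hP _ h.1, hP _ h.2]
    · simp
  simp only [current_apply, hterm]
  rw [mul_smul_comm, mul_finsum]

/-- An endomorphism commuting with all variables is determined by its value at `1`. -/
lemma eq_zero_of_commute_X {σ R : Type*} [CommSemiring R] (L : Module.End R (MvPolynomial σ R))
    (hX : ∀ k f, L (X k * f) = X k * L f) (h1 : L 1 = 0) : L = 0 := by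
  refine LinearMap.ext fun f => ?_
  induction f using MvPolynomial.induction_on with
  | C a => rw [C_eq_smul_one, map_smul, h1, smul_zero, LinearMap.zero_apply]
  | add f g hf hg => simp_all
  | mul_X f k hf => rw [mul_comm, hX, hf]; simp

lemma linNO_one {i j : ℤ} (h : 0 ≤ i ∨ 0 ≤ j) : linNO i j 1 = 0 := by
  unfold linNO
  split_ifs <;> rw [Module.End.mul_apply, linP_one_of_nonneg (by omega), map_zero]

lemma linNO_of_neg {i j : ℤ} (hi : i < 0) (f : MvPolynomial ℤ ℂ) :
    linNO i j f = linP i (linP j f) := by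
  unfold linNO
  split_ifs
  · rfl
  · rw [Module.End.mul_apply, linP_linP, if_neg (by omega), zero_smul, add_zero]

lemma current_one {p : ℕ} {n : ℤ} (hn : 0 ≤ n) : current p n 1 = 0 := by
  rw [current_apply, finsum_eq_zero_of_forall_eq_zero, smul_zero]
  intro i
  unfold pbarTerm
  split_ifs
  · exact linNO_one (by omega)
  · rfl

lemma current_pbarTerm_one {p : ℕ} {n : ℤ} (hp : (p : ℤ) ∣ n) (hn : 0 ≤ n) (i : ℤ) :
    current p n (pbarTerm p (-p) i 1) =
      if n = 0 then (p : ℂ) • pbarTerm p (-p) i 1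
      else if n = p then
        (if -(p : ℤ) < i ∧ i < 0 then ((i * (-p - i) : ℤ) : ℂ) • (1 : MvPolynomial ℤ ℂ) else 0)
      else 0 := by
  by_cases hi : -(p : ℤ) < i ∧ i < 0
  · have h1 : ¬ (p : ℤ) ∣ i := fun h => by
      have := Int.le_of_dvd (by omega) (Int.dvd_neg.2 h); omega
    have h2 : ¬ (p : ℤ) ∣ (-p - i) := by rwa [dvd_sub_right (by simp)]
    have hnp : n = 0 ∨ n = p ∨ n > p := by
      rcases hn.eq_or_lt with h | h
      · exact Or.inl h.symm
      · have := Int.le_of_dvd h hp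
        omega
    rw [pbarTerm, if_pos ⟨h1, h2⟩, linNO_of_neg hi.2, current_linP hp h1,
      current_linP hp h2, current_one hn, map_zero, zero_add, map_smul, if_pos hi]
    rcases hnp with rfl | rfl | hgt
    · simp only [zero_add, if_true, ← add_smul]
      congr 1; push_cast; ring
    · rw [if_neg (by omega), if_pos rfl, linP_one_of_nonneg (by omega : (0 : ℤ) ≤ p + (-p - i)),
        linP_linP, linP_one_of_nonneg (by omega : (0 : ℤ) ≤ p + i), if_pos (by ring)]
      simp only [map_zero, smul_zero, zero_add, smul_smul]
      congr 1; push_cast; ring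
    · rw [if_neg (by omega), if_neg (by omega),
        linP_one_of_nonneg (by omega : (0 : ℤ) ≤ n + (-p - i)),
        linP_linP, linP_one_of_nonneg (by omega : (0 : ℤ) ≤ n + i), if_neg (by omega)]
      simp
  · have h0 : pbarTerm p (-p) i 1 = 0 := by
      unfold pbarTerm
      split_ifs with h
      · have : i ≠ -p := by rintro rfl; exact h.1 (by simp)
        exact linNO_one (by omega)
      · rfl
    simp [h0, hi]

lemma finsum_Ioo_mul (p : ℕ) :
    ∑ᶠ i : ℤ, (if -(p : ℤ) < i ∧ i < 0 then ((i * (-p - i) : ℤ) : ℂ) • (1 : MvPolynomial ℤ ℂ)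
      else 0) = (((p : ℂ) ^ 3 - p) / 6) • 1 := by
  have hsum : ∀ q : ℕ, ∑ k ∈ Finset.range q, ((k : ℂ) * (p - k)) =
      p * (q * (q - 1) / 2) - q * (q - 1) * (2 * q - 1) / 6 := by
    intro q
    induction q with
    | zero => simp
    | succ q ih => rw [Finset.sum_range_succ, ih]; push_cast; ring
  rw [finsum_eq_finsetSum_of_support_subset (s := (Finset.range p).image fun k : ℕ => -(k : ℤ)),
    Finset.sum_image (by intro a _ b _ h; simpa using h)]
  · trans (∑ k ∈ Finset.range p, ((k : ℂ) * (p - k))) • (1 : MvPolynomial ℤ ℂ)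
    · rw [Finset.sum_smul]
      refine Finset.sum_congr rfl fun k hk => ?_
      have := Finset.mem_range.1 hk
      rcases k.eq_zero_or_pos with rfl | hk0
      · simp
      · rw [if_pos (by omega)]
        congr 1; push_cast; ring
    · rw [hsum]; congr 1; ring
  · intro i hi
    have : -(p : ℤ) < i ∧ i < 0 := by
      by_contra h
      exact hi (if_neg h)
    simp only [Finset.coe_image, Set.mem_image, Finset.coe_range, Set.mem_Iio]
    exact ⟨i.natAbs, by omega, by omega⟩

lemma current_current_one {p : ℕ} {n : ℤ} (hp : (p : ℤ) ∣ n) (hn : 0 ≤ n) :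
    current p n (current p (-p) 1) =
      if n = 0 then (p : ℂ) • current p (-p) 1
      else if n = p then (((p : ℂ) ^ 3 - p) / 12) • 1 else 0 := by
  have hs := pbarTerm_support_finite p (-p) 1
  rw [current_apply p (-p), map_smul, map_finsum (current p n) hs]
  simp only [current_pbarTerm_one hp hn]
  split_ifs
  · rw [← smul_finsum, smul_comm]
  · rw [finsum_Ioo_mul, smul_smul]; congr 1; ring
  · simp

/-- The defect of the Virasoro relation for the reduced currents. -/
def virasoroDefect (p : ℕ) (n m : ℤ) : Module.End ℂ (MvPolynomial ℤ ℂ) :=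
  current p (n * p) * current p (m * p) - current p (m * p) * current p (n * p)
    - ((n : ℂ) * p - m * p) • current p ((n + m) * p)
    - ((1 / 12 : ℂ) * (((n * p : ℤ) : ℂ) ^ 3 - ((n * p : ℤ) : ℂ))
            * (if n + m = 0 then 1 else 0)) • 1

lemma virasoroDefect_swap (p : ℕ) (n m : ℤ) : virasoroDefect p m n = -virasoroDefect p n m := by
  unfold virasoroDefect
  have hc : (1 / 12 : ℂ) * (((m * p : ℤ) : ℂ) ^ 3 - ((m * p : ℤ) : ℂ))
        * (if m + n = 0 then 1 else 0)
      = -((1 / 12 : ℂ) * (((n * p : ℤ) : ℂ) ^ 3 - ((n * p : ℤ) : ℂ))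
        * (if n + m = 0 then 1 else 0)) := by
    by_cases h : n + m = 0
    · obtain rfl : m = -n := by omega
      simp; ring
    · rw [if_neg h, if_neg (by omega)]; simp
  rw [hc, add_comm m n]
  module

lemma virasoroDefect_X_mul {p : ℕ} (n m k : ℤ) (f : MvPolynomial ℤ ℂ) :
    virasoroDefect p n m (X k * f) = X k * virasoroDefect p n m f := by
  by_cases hk : k ≤ 0 ∨ (p : ℤ) ∣ k
  · simp only [virasoroDefect, LinearMap.sub_apply, Module.End.mul_apply, LinearMap.smul_apply,
      current_X_mul _ hk, Module.End.one_apply, mul_sub, mul_smul_comm]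
  · push Not at hk
    obtain ⟨hpos, hdvd⟩ := hk
    have hX (g : MvPolynomial ℤ ℂ) : X k * g = (k⁻¹ : ℂ) • linP (-k) g := by
      have : (k : ℂ) ≠ 0 := by exact_mod_cast hpos.ne'
      rw [linP_of_neg (by omega), smul_smul]
      simp [this]
    have hn : (p : ℤ) ∣ n * p := dvd_mul_left _ _
    have hm : (p : ℤ) ∣ m * p := dvd_mul_left _ _
    have hnm : (p : ℤ) ∣ (n + m) * p := dvd_mul_left _ _
    have hk' : ¬ (p : ℤ) ∣ -k := by simpa using hdvd
    have hnk : ¬ (p : ℤ) ∣ n * p + -k := by rwa [dvd_add_right hn]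
    have hmk : ¬ (p : ℤ) ∣ m * p + -k := by rwa [dvd_add_right hm]
    rw [hX, hX, map_smul]
    congr 1
    simp only [virasoroDefect, LinearMap.sub_apply, Module.End.mul_apply, LinearMap.smul_apply,
      current_linP hn hk', current_linP hm hk', current_linP hnm hk', map_add, map_smul, map_sub,
      current_linP hn hmk, current_linP hm hnk, Module.End.one_apply]
    rw [show m * p + (n * p + -k) = (n + m) * p + -k by ring,
      show n * p + (m * p + -k) = (n + m) * p + -k by ring]
    push_cast
    module

lemma virasoroDefect_one_of_nonneg {p : ℕ} (hp : 0 < p) {n m : ℤ} (hn : 0 ≤ n) (hm : -1 ≤ m) :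
    virasoroDefect p n m 1 = 0 := by
  have hp' : (0 : ℤ) < p := by exact_mod_cast hp
  simp only [virasoroDefect, LinearMap.sub_apply, Module.End.mul_apply, LinearMap.smul_apply,
    current_one (by positivity : 0 ≤ n * (p : ℤ)), map_zero, sub_zero, Module.End.one_apply]
  rcases hm.eq_or_lt with rfl | hm
  · rw [neg_one_mul, current_current_one (dvd_mul_left _ _) (by positivity)]
    by_cases h0 : n = 0
    · subst h0; simp
    by_cases h1 : n = 1
    · subst h1
      simp [current_one, hp.ne']
      module
    · rw [if_neg (by positivity), if_neg (by simp [h1, hp.ne']), if_neg (by omega),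
        current_one (mul_nonneg (by omega) hp'.le)]
      simp
  · have hm0 : 0 ≤ m := by omega
    rw [current_one (by positivity), current_one (by positivity)]
    by_cases h : n + m = 0
    · obtain rfl : n = 0 := by omega
      simp
    · simp [h]

lemma virasoroDefect_eq_zero {p : ℕ} (hp : 0 < p) {n m : ℤ} (hn : -1 ≤ n) (hm : -1 ≤ m) :
    virasoroDefect p n m = 0 := by
  refine eq_zero_of_commute_X _ (virasoroDefect_X_mul n m) ?_
  rcases hn.eq_or_lt with rfl | hn
  · rcases hm.eq_or_lt with rfl | hm
    · simp [virasoroDefect]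
    · rw [virasoroDefect_swap, LinearMap.neg_apply,
        virasoroDefect_one_of_nonneg hp (by omega) le_rfl, neg_zero]
  · exact virasoroDefect_one_of_nonneg hp (by omega) hm

theorem reduced_virasoro (p : ℕ) (hp : 2 ≤ p) (n m : ℤ)
    (hn : -1 ≤ n) (hm : -1 ≤ m) (f : MvPolynomial ℤ ℂ) :
    (1 / 2 : ℂ) • Pbar p (n * p) ((1 / 2 : ℂ) • Pbar p (m * p) f)
      - (1 / 2 : ℂ) • Pbar p (m * p) ((1 / 2 : ℂ) • Pbar p (n * p) f)
      = (1 / 2 : ℂ) • ((((n : ℂ)) * p - (m : ℂ) * p) • Pbar p ((n + m) * p) f)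
        + ((1 / 12 : ℂ) * (((n * p : ℤ) : ℂ) ^ 3 - ((n * p : ℤ) : ℂ))
            * (if n + m = 0 then 1 else 0)) • f := by
  have h := LinearMap.congr_fun (virasoroDefect_eq_zero (by omega : 0 < p) hn hm) f
  simp only [virasoroDefect, LinearMap.sub_apply, Module.End.mul_apply, LinearMap.smul_apply,
    Module.End.one_apply, LinearMap.zero_apply, sub_sub _ (_ • _) (_ • f)] at h
  rw [sub_eq_zero] at h
  rw [smul_comm (1 / 2 : ℂ) (_ - _ : ℂ)]
  exact h

end
end

section
/- Let Φ = 1 + ∑_{j≥1} w_j(t) ∂^{−j} be an invertible Volterra-type pseudo-differential operator and L = Φ ∘ ∂ ∘ Φ^{−1}. Then the Sato equation ∂Φ/∂t_i = −(L^i)_− ∘ Φ implies the Lax equation ∂L/∂t_i = [(L^i)_+, L], where R_+ and R_− denote the differential-operator and Volterra parts of a pseudo-differential operator R. -/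
/-!
Statement 17: Let `Φ = 1 + ∑_{j≥1} w_j ∂^{-j}` be an invertible Volterra-type
pseudo-differential operator and `L = Φ ∘ ∂ ∘ Φ⁻¹`.  Then the Sato equation
`∂Φ/∂t_i = -(L^i)_- ∘ Φ` implies the Lax equation `∂L/∂t_i = [(L^i)_+, L]`.

Formalization: pseudo-differential operators over a commutative ℚ-algebra `F`
(of "functions of t₁, t₂, …") are represented by coefficient families `ℤ → F`,
with composition `pmul` given by the Leibniz expansion
`∂^j ∘ f = ∑_i C(j,i)(∂^i f)∂^{j-i}` where the derivation is `D = ∂/∂t₁ = dt 1`.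
The time derivatives `dt i` are commuting derivations on `F` and act on operators
coefficientwise.
-/

open Finset

noncomputable section

def genBinom (j : ℤ) (i : ℕ) : ℚ :=
  (∏ k ∈ Finset.range i, ((j : ℚ) - k)) / (i.factorial : ℚ)

variable {F : Type*} [CommRing F] [Algebra ℚ F]

/-- Composition of pseudo-differential operators (locally finite sums). -/
def pmul (D : F → F) (A B : ℤ → F) : ℤ → F := fun k =>
  ∑ᶠ j : ℤ, ∑ᶠ i : ℕ,
    algebraMap ℚ F (genBinom j i) * A j * D^[i] (B (k - j + i))

/-- The identity operator. -/
def pone : ℤ → F := fun k => if k = 0 then 1 else 0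

/-- The operator `∂^n`. -/
def delta (n : ℤ) : ℤ → F := fun k => if k = n then 1 else 0

/-- Differential-operator part `R₊`. -/
def pplus (A : ℤ → F) : ℤ → F := fun k => if 0 ≤ k then A k else 0

/-- Volterra part `R₋`. -/
def pminus (A : ℤ → F) : ℤ → F := fun k => if k < 0 then A k else 0

/-- Nonnegative powers of an operator. -/
def ppow (D : F → F) (A : ℤ → F) : ℕ → (ℤ → F)
  | 0 => pone
  | n + 1 => pmul D A (ppow D A n)

/-! ### Generalized binomial coefficients -/

theorem genBinom_eq_choose (j : ℤ) (i : ℕ) : genBinom j i = Ring.choose (j : ℚ) i := by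
  rw [genBinom, Ring.choose_eq_smul, ← Polynomial.aeval_eq_smeval, Polynomial.aeval_def,
    Polynomial.eval₂_eq_eval_map, descPochhammer_map, descPochhammer_eval_eq_prod_range,
    smul_eq_mul, div_eq_inv_mul]

@[simp]
theorem genBinom_zero_right (j : ℤ) : genBinom j 0 = 1 := by simp [genBinom]

theorem genBinom_zero_left {i : ℕ} (hi : i ≠ 0) : genBinom 0 i = 0 := by
  rw [genBinom, Finset.prod_eq_zero (Finset.mem_range.2 (Nat.pos_of_ne_zero hi)) (by simp),
    zero_div]

theorem genBinom_add (r s : ℤ) (n : ℕ) :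
    genBinom (r + s) n = ∑ p ∈ antidiagonal n, genBinom r p.1 * genBinom s p.2 := by
  simp only [genBinom_eq_choose]
  rw [Int.cast_add, Ring.add_choose_eq n (Commute.all _ _)]

theorem choose_mul_genBinom (r : ℤ) (u v : ℕ) :
    ((u + v).choose u : ℚ) * genBinom r (u + v) = genBinom r u * genBinom (r - u) v := by
  have h := Ring.choose_smul_choose (r : ℚ) (Nat.le_add_right u v)
  simpa [genBinom_eq_choose] using h

theorem sum_antidiagonal_antidiagonal {M : Type*} [AddCommMonoid M] (s : ℕ)
    (f : ℕ → ℕ → ℕ → M) :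
    ∑ p ∈ antidiagonal s, ∑ q ∈ antidiagonal p.1, f q.1 q.2 p.2
      = ∑ p ∈ antidiagonal s, ∑ q ∈ antidiagonal p.2, f p.1 q.1 q.2 := by
  rw [Finset.sum_sigma', Finset.sum_sigma']
  refine Finset.sum_nbij' (fun x => ⟨(x.2.1, x.2.2 + x.1.2), (x.2.2, x.1.2)⟩)
    (fun x => ⟨(x.1.1 + x.2.1, x.2.2), (x.1.1, x.2.1)⟩) ?_ ?_ ?_ ?_ ?_
  all_goals
    rintro ⟨⟨a, b⟩, ⟨c, d⟩⟩
    simp only [Finset.mem_sigma, HasAntidiagonal.mem_antidiagonal]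
    rintro ⟨h₁, h₂⟩
  · exact ⟨by omega, trivial⟩
  · exact ⟨by omega, trivial⟩
  · subst h₂; rfl
  · subst h₂; rfl
  · trivial

/-- The general Leibniz rule for derivations. -/
theorem Derivation.iterate_mul (D : Derivation ℚ F F) (n : ℕ) (x y : F) :
    D^[n] (x * y)
      = ∑ p ∈ antidiagonal n, (n.choose p.1 : F) * (D^[p.1] x * D^[p.2] y) := by
  induction n with
  | zero => simp
  | succ n ih =>
    rw [Finset.sum_antidiagonal_choose_succ_mul (fun i j => D^[i] x * D^[j] y) n,
      Function.iterate_succ_apply', ih, map_sum, ← Finset.sum_add_distrib]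
    refine Finset.sum_congr rfl fun ⟨i, j⟩ hij => ?_
    rw [← n.choose_symm_of_eq_add (HasAntidiagonal.mem_antidiagonal.1 hij).symm]
    simp only [Function.iterate_succ_apply', Derivation.leibniz, Derivation.map_natCast,
      smul_eq_mul]
    ring

theorem Derivation.iterate_algebraMap_mul (D : Derivation ℚ F F) (n : ℕ) (q : ℚ) (x : F) :
    D^[n] (algebraMap ℚ F q * x) = algebraMap ℚ F q * D^[n] x := by
  induction n with
  | zero => rfl
  | succ n ih => simp [Function.iterate_succ_apply', ih]

/-! ### Products of monomials -/

/-- The coefficient of `∂^k` in `(x ∂^j) ∘ (y ∂^m)`. -/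
def monoMul (D : Derivation ℚ F F) (j m : ℤ) (x y : F) (k : ℤ) : F :=
  if k ≤ j + m then
    algebraMap ℚ F (genBinom j (j + m - k).toNat) * x * D^[(j + m - k).toNat] y
  else 0

section monoMul

variable (D : Derivation ℚ F F) (j m n k : ℤ)

theorem monoMul_of_lt (x y : F) (h : j + m < k) : monoMul D j m x y k = 0 :=
  if_neg (not_le.2 h)

theorem monoMul_eq (x y : F) {i : ℕ} (h : k + i = j + m) :
    monoMul D j m x y k = algebraMap ℚ F (genBinom j i) * x * D^[i] y := by
  have hi : (j + m - k).toNat = i := by omega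
  rw [monoMul, if_pos (by omega), hi]

@[simp]
theorem monoMul_zero_left (y : F) : monoMul D j m 0 y k = 0 := by simp [monoMul]

@[simp]
theorem monoMul_zero_right (x : F) : monoMul D j m x 0 k = 0 := by
  simp [monoMul, iterate_map_zero]

theorem monoMul_add_left (x x' y : F) :
    monoMul D j m (x + x') y k = monoMul D j m x y k + monoMul D j m x' y k := by
  unfold monoMul
  split_ifs
  · ring
  · simp

theorem monoMul_add_right (x y y' : F) :
    monoMul D j m x (y + y') k = monoMul D j m x y k + monoMul D j m x y' k := by
  unfold monoMul
  split_ifs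
  · rw [iterate_map_add]; ring
  · simp

theorem monoMul_sum_left {ι : Type*} (s : Finset ι) (f : ι → F) (y : F) :
    monoMul D j m (∑ i ∈ s, f i) y k = ∑ i ∈ s, monoMul D j m (f i) y k :=
  map_sum (AddMonoidHom.mk' (fun x => monoMul D j m x y k)
    fun x x' => monoMul_add_left D j m k x x' y) f s

theorem monoMul_sum_right {ι : Type*} (s : Finset ι) (x : F) (f : ι → F) :
    monoMul D j m x (∑ i ∈ s, f i) k = ∑ i ∈ s, monoMul D j m x (f i) k :=
  map_sum (AddMonoidHom.mk' (fun y => monoMul D j m x y k)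
    fun y y' => monoMul_add_right D j m k x y y') f s

theorem map_monoMul (E : Derivation ℚ F F) (hED : Function.Commute E D) (x y : F) :
    E (monoMul D j m x y k) = monoMul D j m (E x) y k + monoMul D j m x (E y) k := by
  unfold monoMul
  split_ifs
  · rw [← (hED.iterate_right _).eq y]
    simp only [Derivation.leibniz, Derivation.map_algebraMap, smul_eq_mul]
    ring
  · simp

theorem sum_monoMul_monoMul_left (x y z : F) {J : Finset ℤ} {s : ℕ} (hs : k + s = j + m + n)
    (hJ : Icc (k - n) (j + m) ⊆ J) :
    ∑ j' ∈ J, monoMul D j' n (monoMul D j m x y j') z k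
      = ∑ p ∈ antidiagonal s, algebraMap ℚ F (genBinom j p.1 * genBinom (j + m - p.1) p.2)
          * (x * D^[p.1] y * D^[p.2] z) := by
  symm
  refine Finset.sum_of_injOn (fun p : ℕ × ℕ => j + m - (p.1 : ℤ)) ?_ ?_ ?_ ?_
  · rintro ⟨a, b⟩ h ⟨c, d⟩ h' hac
    simp only [Finset.mem_coe, HasAntidiagonal.mem_antidiagonal] at h h' hac
    ext <;> simp only <;> omega
  · rintro ⟨a, b⟩ h
    simp only [Finset.mem_coe, HasAntidiagonal.mem_antidiagonal] at h
    exact hJ (Finset.mem_Icc.2 (by constructor <;> simp only <;> omega))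
  · intro j' _ h
    rcases lt_or_ge (j + m) j' with h₁ | h₁
    · rw [monoMul_of_lt D j m j' x y h₁, monoMul_zero_left]
    rcases lt_or_ge (j' + n) k with h₂ | h₂
    · rw [monoMul_of_lt D j' n k _ z h₂]
    refine absurd ⟨((j + m - j').toNat, (j' + n - k).toNat), ?_, ?_⟩ h
    · simp only [Finset.mem_coe, HasAntidiagonal.mem_antidiagonal]; omega
    · simp only; omega
  · rintro ⟨a, b⟩ h
    rw [HasAntidiagonal.mem_antidiagonal] at h
    simp only at h ⊢
    rw [monoMul_eq D j m _ x y (i := a) (by omega), monoMul_eq D _ n k _ z (i := b) (by omega),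
      map_mul]
    ring

theorem sum_monoMul_monoMul_right (x y z : F) {J : Finset ℤ} {s : ℕ} (hs : k + s = j + m + n)
    (hJ : Icc (k - j) (m + n) ⊆ J) :
    ∑ m' ∈ J, monoMul D j m' x (monoMul D m n y z m') k
      = ∑ p ∈ antidiagonal s, algebraMap ℚ F (genBinom j p.1 * genBinom m p.2)
          * (x * D^[p.1] (y * D^[p.2] z)) := by
  symm
  refine Finset.sum_of_injOn (fun p : ℕ × ℕ => m + n - (p.2 : ℤ)) ?_ ?_ ?_ ?_
  · rintro ⟨a, b⟩ h ⟨c, d⟩ h' hac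
    simp only [Finset.mem_coe, HasAntidiagonal.mem_antidiagonal] at h h' hac
    ext <;> simp only <;> omega
  · rintro ⟨a, b⟩ h
    simp only [Finset.mem_coe, HasAntidiagonal.mem_antidiagonal] at h
    exact hJ (Finset.mem_Icc.2 (by constructor <;> simp only <;> omega))
  · intro m' _ h
    rcases lt_or_ge (m + n) m' with h₁ | h₁
    · rw [monoMul_of_lt D m n m' y z h₁, monoMul_zero_right]
    rcases lt_or_ge (j + m') k with h₂ | h₂
    · rw [monoMul_of_lt D j m' k x _ h₂]
    refine absurd ⟨((j + m' - k).toNat, (m + n - m').toNat), ?_, ?_⟩ h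
    · simp only [Finset.mem_coe, HasAntidiagonal.mem_antidiagonal]; omega
    · simp only; omega
  · rintro ⟨a, b⟩ h
    rw [HasAntidiagonal.mem_antidiagonal] at h
    simp only at h ⊢
    rw [monoMul_eq D m n _ y z (i := b) (by omega), monoMul_eq D j _ k x _ (i := a) (by omega),
      mul_assoc (algebraMap ℚ F (genBinom m b)), Derivation.iterate_algebraMap_mul, map_mul]
    ring

theorem sum_antidiagonal_genBinom (x y z : F) (s : ℕ) :
    ∑ p ∈ antidiagonal s, algebraMap ℚ F (genBinom j p.1 * genBinom (j + m - p.1) p.2)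
        * (x * D^[p.1] y * D^[p.2] z)
      = ∑ p ∈ antidiagonal s, algebraMap ℚ F (genBinom j p.1 * genBinom m p.2)
          * (x * D^[p.1] (y * D^[p.2] z)) := by
  let f : ℕ → ℕ → ℕ → F := fun u v l =>
    algebraMap ℚ F (genBinom j u * genBinom (j - u) v * genBinom m l)
      * (x * D^[u] y * D^[v + l] z)
  have hr : ∀ p ∈ antidiagonal s, algebraMap ℚ F (genBinom j p.1 * genBinom m p.2)
      * (x * D^[p.1] (y * D^[p.2] z)) = ∑ q ∈ antidiagonal p.1, f q.1 q.2 p.2 := by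
    rintro ⟨a, b⟩ -
    simp only
    rw [Derivation.iterate_mul, Finset.mul_sum, Finset.mul_sum]
    refine Finset.sum_congr rfl ?_
    rintro ⟨u, v⟩ h
    obtain rfl : u + v = a := HasAntidiagonal.mem_antidiagonal.1 h
    simp only [f]
    rw [← choose_mul_genBinom, Function.iterate_add_apply]
    simp only [map_mul, map_natCast]
    ring
  rw [Finset.sum_congr rfl hr, sum_antidiagonal_antidiagonal]
  refine Finset.sum_congr rfl ?_
  rintro ⟨u, l⟩ -
  simp only [f]
  rw [show j + m - (u : ℤ) = (j - u) + m by ring, genBinom_add, Finset.mul_sum, map_sum,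
    Finset.sum_mul]
  refine Finset.sum_congr rfl ?_
  rintro ⟨v, l'⟩ h
  obtain rfl : v + l' = l := HasAntidiagonal.mem_antidiagonal.1 h
  simp only [map_mul]
  ring

theorem sum_monoMul_assoc (x y z : F) {J : Finset ℤ} (hJ : Icc (k - n) (j + m) ⊆ J)
    (hJ' : Icc (k - j) (m + n) ⊆ J) :
    ∑ j' ∈ J, monoMul D j' n (monoMul D j m x y j') z k
      = ∑ m' ∈ J, monoMul D j m' x (monoMul D m n y z m') k := by
  rcases le_or_gt k (j + m + n) with h | h
  · have hs : k + ((j + m + n - k).toNat : ℕ) = j + m + n := by omega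
    rw [sum_monoMul_monoMul_left D j m n k x y z hs hJ,
      sum_monoMul_monoMul_right D j m n k x y z hs hJ', sum_antidiagonal_genBinom]
  · rw [Finset.sum_eq_zero, Finset.sum_eq_zero]
    · intro m' _
      rcases lt_or_ge (m + n) m' with h₁ | h₁
      · rw [monoMul_of_lt D m n m' y z h₁, monoMul_zero_right]
      · rw [monoMul_of_lt D j m' k x _ (by omega)]
    · intro j' _
      rcases lt_or_ge (j + m) j' with h₁ | h₁
      · rw [monoMul_of_lt D j m j' x y h₁, monoMul_zero_left]
      · rw [monoMul_of_lt D j' n k _ z (by omega)]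

end monoMul

/-! ### The ring of pseudo-differential operators -/

/-- `A` has order at most `a`. -/
def OrdLE (A : ℤ → F) (a : ℤ) : Prop := ∀ k, a < k → A k = 0

theorem OrdLE.mono {R : Type*} [CommRing R] {A : ℤ → R} {a b : ℤ} (hA : OrdLE A a) (h : a ≤ b) : OrdLE A b :=
  fun k hk => hA k (h.trans_lt hk)

section pmul

variable (D : Derivation ℚ F F) {A B C : ℤ → F} {a b c : ℤ}

theorem pmul_eq_sum (hA : OrdLE A a) (hB : OrdLE B b) (k : ℤ) {J J' : Finset ℤ}
    (hJ : Icc (k - b) a ⊆ J) (hJ' : Icc (k - a) b ⊆ J') :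
    pmul D A B k = ∑ j ∈ J, ∑ m ∈ J', monoMul D j m (A j) (B m) k := by
  have inner : ∀ j, ∑ᶠ i : ℕ, algebraMap ℚ F (genBinom j i) * A j * D^[i] (B (k - j + i))
      = ∑ m ∈ J', monoMul D j m (A j) (B m) k := by
    intro j
    rcases lt_or_ge a j with hj | hj
    · simp [hA j hj]
    rw [finsum_eq_sum_of_support_subset (s := (J'.filter (fun m => k ≤ j + m)).image
      (fun m => (j + m - k).toNat)), Finset.sum_image, Finset.sum_filter]
    · refine Finset.sum_congr rfl fun m _ => ?_
      unfold monoMul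
      split_ifs with h
      · rw [show k - j + ((j + m - k).toNat : ℤ) = m by omega]
      · rfl
    · intro m hm m' hm' h
      simp only [Finset.coe_filter, Set.mem_ofPred_eq] at hm hm' h
      omega
    · intro i hi
      rw [Function.mem_support] at hi
      have hle : k - j + i ≤ b := by
        by_contra! hlt
        exact hi (by rw [hB _ hlt, iterate_map_zero, mul_zero])
      simp only [Finset.coe_image, Finset.coe_filter, Set.mem_image, Set.mem_ofPred_eq]
      exact ⟨k - j + i, ⟨hJ' (Finset.mem_Icc.2 ⟨by omega, hle⟩), by omega⟩, by omega⟩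
  unfold pmul
  rw [finsum_congr inner]
  refine finsum_eq_sum_of_support_subset _ fun j hj => ?_
  rw [Function.mem_support] at hj
  by_contra hjJ
  refine hj (Finset.sum_eq_zero fun m _ => ?_)
  rcases lt_or_ge a j with h | h
  · rw [hA j h, monoMul_zero_left]
  rcases lt_or_ge b m with h' | h'
  · rw [hB m h', monoMul_zero_right]
  refine monoMul_of_lt D j m k _ _ ?_
  by_contra! h''
  exact hjJ (hJ (Finset.mem_Icc.2 ⟨by omega, h⟩))

theorem OrdLE.pmul (hA : OrdLE A a) (hB : OrdLE B b) : OrdLE (pmul D A B) (a + b) := by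
  intro k hk
  rw [pmul_eq_sum D hA hB k subset_rfl subset_rfl]
  refine Finset.sum_eq_zero fun j hj => Finset.sum_eq_zero fun m hm => ?_
  rw [Finset.mem_Icc] at hj hm
  exact monoMul_of_lt D j m k _ _ (by omega)

theorem pmul_assoc (hA : OrdLE A a) (hB : OrdLE B b) (hC : OrdLE C c) :
    pmul D (pmul D A B) C = pmul D A (pmul D B C) := by
  funext k
  let N : ℤ := |a| + |b| + |c| + |k|
  have ha := abs_le.1 (le_refl |a|)
  have hb := abs_le.1 (le_refl |b|)
  have hc := abs_le.1 (le_refl |c|)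
  have hk := abs_le.1 (le_refl |k|)
  let J : Finset ℤ := Icc (-N) N
  let K : Finset ℤ := Icc (-(2 * N)) (2 * N)
  have hL : pmul D (pmul D A B) C k = ∑ j ∈ K, ∑ m ∈ K, ∑ n ∈ K, ∑ j' ∈ J,
      monoMul D j' n (monoMul D j m (A j) (B m) j') (C n) k := by
    rw [pmul_eq_sum D (hA.pmul D hB) hC k (J := J) (J' := K)
      (Finset.Icc_subset_Icc (by omega) (by omega))
      (Finset.Icc_subset_Icc (by omega) (by omega))]
    have : ∀ j' ∈ J, ∑ n ∈ K, monoMul D j' n (pmul D A B j') (C n) k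
        = ∑ j ∈ K, ∑ m ∈ K, ∑ n ∈ K,
          monoMul D j' n (monoMul D j m (A j) (B m) j') (C n) k := by
      intro j' hj'
      rw [Finset.mem_Icc] at hj'
      rw [pmul_eq_sum D hA hB j' (J := K) (J' := K)
        (Finset.Icc_subset_Icc (by omega) (by omega))
        (Finset.Icc_subset_Icc (by omega) (by omega))]
      simp only [monoMul_sum_left]
      rw [Finset.sum_comm]
      refine Finset.sum_congr rfl fun j _ => ?_
      rw [Finset.sum_comm]
    rw [Finset.sum_congr rfl this, Finset.sum_comm]
    refine Finset.sum_congr rfl fun j _ => ?_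
    rw [Finset.sum_comm]
    refine Finset.sum_congr rfl fun m _ => ?_
    rw [Finset.sum_comm]
  have hR : pmul D A (pmul D B C) k = ∑ j ∈ K, ∑ m ∈ K, ∑ n ∈ K, ∑ m' ∈ J,
      monoMul D j m' (A j) (monoMul D m n (B m) (C n) m') k := by
    rw [pmul_eq_sum D hA (hB.pmul D hC) k (J := K) (J' := J)
      (Finset.Icc_subset_Icc (by omega) (by omega))
      (Finset.Icc_subset_Icc (by omega) (by omega))]
    refine Finset.sum_congr rfl fun j _ => ?_
    have : ∀ m' ∈ J, monoMul D j m' (A j) (pmul D B C m') k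
        = ∑ m ∈ K, ∑ n ∈ K, monoMul D j m' (A j) (monoMul D m n (B m) (C n) m') k := by
      intro m' hm'
      rw [Finset.mem_Icc] at hm'
      rw [pmul_eq_sum D hB hC m' (J := K) (J' := K)
        (Finset.Icc_subset_Icc (by omega) (by omega))
        (Finset.Icc_subset_Icc (by omega) (by omega))]
      simp only [monoMul_sum_right]
    rw [Finset.sum_congr rfl this, Finset.sum_comm]
    refine Finset.sum_congr rfl fun m _ => ?_
    rw [Finset.sum_comm]
  rw [hL, hR]
  refine Finset.sum_congr rfl fun j _ => Finset.sum_congr rfl fun m _ =>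
    Finset.sum_congr rfl fun n _ => ?_
  rcases lt_or_ge a j with hj | hj
  · simp [hA j hj]
  rcases lt_or_ge b m with hm | hm
  · simp [hB m hm]
  rcases lt_or_ge c n with hn | hn
  · simp [hC n hn]
  exact sum_monoMul_assoc D j m n k _ _ _
    (Finset.Icc_subset_Icc (by omega) (by omega))
    (Finset.Icc_subset_Icc (by omega) (by omega))

theorem pmul_add_left (hA : OrdLE A a) (hB : OrdLE B a) (hC : OrdLE C c) :
    pmul D (A + B) C = pmul D A C + pmul D B C := by
  have hAB : OrdLE (A + B) a := fun k hk => by simp [hA k hk, hB k hk]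
  funext k
  rw [Pi.add_apply, pmul_eq_sum D hAB hC k subset_rfl subset_rfl,
    pmul_eq_sum D hA hC k subset_rfl subset_rfl, pmul_eq_sum D hB hC k subset_rfl subset_rfl]
  simp only [Pi.add_apply, monoMul_add_left, Finset.sum_add_distrib]

theorem pmul_add_right (hA : OrdLE A a) (hB : OrdLE B b) (hC : OrdLE C b) :
    pmul D A (B + C) = pmul D A B + pmul D A C := by
  have hBC : OrdLE (B + C) b := fun k hk => by simp [hB k hk, hC k hk]
  funext k
  rw [Pi.add_apply, pmul_eq_sum D hA hBC k subset_rfl subset_rfl,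
    pmul_eq_sum D hA hB k subset_rfl subset_rfl, pmul_eq_sum D hA hC k subset_rfl subset_rfl]
  simp only [Pi.add_apply, monoMul_add_right, Finset.sum_add_distrib]

theorem map_pmul (E : Derivation ℚ F F) (hED : Function.Commute E D)
    (hA : OrdLE A a) (hB : OrdLE B b) :
    E ∘ pmul D A B = pmul D (E ∘ A) B + pmul D A (E ∘ B) := by
  have hEA : OrdLE (E ∘ A) a := fun k hk => by simp [hA k hk]
  have hEB : OrdLE (E ∘ B) b := fun k hk => by simp [hB k hk]
  funext k
  rw [Function.comp_apply, Pi.add_apply, pmul_eq_sum D hA hB k subset_rfl subset_rfl,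
    pmul_eq_sum D hEA hB k subset_rfl subset_rfl, pmul_eq_sum D hA hEB k subset_rfl subset_rfl]
  simp only [map_sum, map_monoMul D _ _ _ E hED, Finset.sum_add_distrib, Function.comp_apply]

theorem pone_pmul (B : ℤ → F) : pmul D pone B = B := by
  funext k
  unfold pmul
  rw [finsum_eq_single _ 0, finsum_eq_single _ 0]
  · simp [pone]
  · intro i hi
    simp [genBinom_zero_left hi]
  · intro j hj
    simp [pone, hj]

theorem pmul_pone (A : ℤ → F) : pmul D A pone = A := by
  funext k
  have hpone : ∀ (i : ℕ) (l : ℤ), i ≠ 0 → D^[i] (pone l) = 0 := by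
    intro i l hi
    obtain ⟨i, rfl⟩ := Nat.exists_eq_succ_of_ne_zero hi
    have : D (pone l) = 0 := by
      unfold pone
      split_ifs <;> simp
    rw [Function.iterate_succ_apply, this, iterate_map_zero]
  have inner : ∀ j, ∑ᶠ i : ℕ, algebraMap ℚ F (genBinom j i) * A j * D^[i] (pone (k - j + i))
      = A j * pone (k - j) := by
    intro j
    rw [finsum_eq_single _ 0 fun i hi => by rw [hpone i _ hi, mul_zero]]
    simp
  unfold pmul
  rw [finsum_congr inner, finsum_eq_single _ k]
  · simp [pone]
  · intro j hj
    simp [pone, sub_eq_zero, hj.symm]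

end pmul

/-- The additive group of coefficient families of bounded order. -/
def boundedFamilies (F : Type*) [CommRing F] : AddSubgroup (ℤ → F) where
  carrier := {A | ∃ a, OrdLE A a}
  zero_mem' := ⟨0, fun _ _ => rfl⟩
  add_mem' := by
    rintro A B ⟨a, hA⟩ ⟨b, hB⟩
    refine ⟨max a b, fun k hk => ?_⟩
    rw [Pi.add_apply, hA k ((le_max_left a b).trans_lt hk),
      hB k ((le_max_right a b).trans_lt hk), add_zero]
  neg_mem' := by
    rintro A ⟨a, hA⟩
    exact ⟨a, fun k hk => by rw [Pi.neg_apply, hA k hk, neg_zero]⟩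

/-- Pseudo-differential operators with respect to the derivation `D`. -/
def PDO (_D : Derivation ℚ F F) : Type _ := boundedFamilies F

namespace PDO

variable (D : Derivation ℚ F F)

instance : AddCommGroup (PDO D) := inferInstanceAs (AddCommGroup (boundedFamilies F))

instance : Ring (PDO D) where
  __ : AddCommGroup (PDO D) := inferInstance
  mul A B := ⟨pmul D A.1 B.1, by
    obtain ⟨a, hA⟩ := A.2
    obtain ⟨b, hB⟩ := B.2
    exact ⟨a + b, hA.pmul D hB⟩⟩
  one := ⟨pone, 0, fun k hk => if_neg hk.ne'⟩
  mul_assoc := by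
    rintro ⟨A, a, hA⟩ ⟨B, b, hB⟩ ⟨C, c, hC⟩
    exact Subtype.ext (pmul_assoc D hA hB hC)
  one_mul A := Subtype.ext (pone_pmul D A.1)
  mul_one A := Subtype.ext (pmul_pone D A.1)
  left_distrib := by
    rintro ⟨A, a, hA⟩ ⟨B, b, hB⟩ ⟨C, c, hC⟩
    exact Subtype.ext
      (pmul_add_right D hA (hB.mono (le_max_left b c)) (hC.mono (le_max_right b c)))
  right_distrib := by
    rintro ⟨A, a, hA⟩ ⟨B, b, hB⟩ ⟨C, c, hC⟩
    exact Subtype.ext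
      (pmul_add_left D (hA.mono (le_max_left a b)) (hB.mono (le_max_right a b)) hC)
  zero_mul := by
    rintro ⟨A, a, hA⟩
    refine Subtype.ext (funext fun k => ?_)
    change pmul D 0 A k = 0
    simp [pmul]
  mul_zero := by
    rintro ⟨A, a, hA⟩
    refine Subtype.ext (funext fun k => ?_)
    change pmul D A 0 k = 0
    simp [pmul, iterate_map_zero]

variable {D}

theorem coe_pow (A : PDO D) (n : ℕ) : (A ^ n).1 = ppow D A.1 n := by
  induction n with
  | zero => rfl
  | succ n ih =>
    rw [pow_succ', ppow, ← ih]
    rfl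

/-- The coefficientwise action of a derivation. -/
def map (E : Derivation ℚ F F) (A : PDO D) : PDO D :=
  ⟨E ∘ A.1, by
    obtain ⟨a, hA⟩ := A.2
    exact ⟨a, fun k hk => by rw [Function.comp_apply, hA k hk, map_zero]⟩⟩

theorem map_mul {E : Derivation ℚ F F} (hED : Function.Commute E D) (A B : PDO D) :
    map E (A * B) = map E A * B + A * map E B := by
  obtain ⟨A, a, hA⟩ := A
  obtain ⟨B, b, hB⟩ := B
  exact Subtype.ext (map_pmul D E hED hA hB)

end PDO

/-- The Sato equation implies the Lax equation for an additive map `δ` obeying the Leibniz rule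
and vanishing on `1` and on `d`. -/
theorem lax_of_sato {R : Type*} [Ring R] (δ : R → R)
    (hδ : ∀ x y, δ (x * y) = δ x * y + x * δ y) (hδ₁ : δ 1 = 0)
    {d Φ Ψ P Q : R} (hd : δ d = 0) (h₁ : Φ * Ψ = 1) (h₂ : Ψ * Φ = 1) {n : ℕ}
    (hPQ : (Φ * d * Ψ) ^ n = P + Q) (hSato : δ Φ = -(P * Φ)) :
    δ (Φ * d * Ψ) = Q * (Φ * d * Ψ) - Φ * d * Ψ * Q := by
  have hΨ : δ Ψ = Ψ * P := by
    have h : δ Φ * Ψ + Φ * δ Ψ = 0 := by rw [← hδ, h₁, hδ₁]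
    rw [hSato, neg_mul, mul_assoc, h₁, mul_one, neg_add_eq_zero] at h
    rw [h, ← mul_assoc, h₂, one_mul]
  have hcomm : (P + Q) * (Φ * d * Ψ) = Φ * d * Ψ * (P + Q) := by
    rw [← hPQ, ← pow_succ, ← pow_succ']
  rw [add_mul, mul_add] at hcomm
  have hδL : δ (Φ * d * Ψ) = Φ * d * Ψ * P - P * (Φ * d * Ψ) := by
    rw [hδ, hδ, hd, hSato, hΨ]
    noncomm_ring
  rw [hδL, sub_eq_sub_iff_add_eq_add, ← hcomm, add_comm]

theorem sato_implies_lax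
    (dt : ℕ+ → F → F)
    (hadd : ∀ i a b, dt i (a + b) = dt i a + dt i b)
    (hleib : ∀ i a b, dt i (a * b) = a * dt i b + dt i a * b)
    (hconst : ∀ i q, dt i (algebraMap ℚ F q) = 0)
    (hcomm : ∀ i j a, dt i (dt j a) = dt j (dt i a))
    (w : ℕ+ → F)
    -- `Φ = 1 + ∑_{j ≥ 1} w_j ∂^{-j}`
    (Φ : ℤ → F)
    (hΦ : Φ = fun k => if k = 0 then 1 else if hk : k < 0 then w ⟨(-k).toNat, by omega⟩ else 0)
    -- `Φ` is invertible with Volterra-type inverse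
    (Φinv : ℤ → F) (hΦinv0 : Φinv 0 = 1) (hΦinvsupp : ∀ k : ℤ, 0 < k → Φinv k = 0)
    (hinv₁ : pmul (dt 1) Φ Φinv = pone) (hinv₂ : pmul (dt 1) Φinv Φ = pone)
    (i : ℕ+)
    -- Sato equation `∂Φ/∂t_i = -(L^i)_- ∘ Φ`, where `L = Φ ∘ ∂ ∘ Φ⁻¹`
    (hSato : ∀ k : ℤ, dt i (Φ k)
      = -(pmul (dt 1)
            (pminus (ppow (dt 1) (pmul (dt 1) (pmul (dt 1) Φ (delta 1)) Φinv) (i : ℕ)))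
            Φ) k) :
    -- Lax equation `∂L/∂t_i = [(L^i)_+, L]`
    ∀ k : ℤ,
      dt i ((pmul (dt 1) (pmul (dt 1) Φ (delta 1)) Φinv) k)
        = (pmul (dt 1)
              (pplus (ppow (dt 1) (pmul (dt 1) (pmul (dt 1) Φ (delta 1)) Φinv) (i : ℕ)))
              (pmul (dt 1) (pmul (dt 1) Φ (delta 1)) Φinv)) k
          - (pmul (dt 1)
              (pmul (dt 1) (pmul (dt 1) Φ (delta 1)) Φinv)
              (pplus (ppow (dt 1) (pmul (dt 1) (pmul (dt 1) Φ (delta 1)) Φinv) (i : ℕ)))) k := by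
  let E : ℕ+ → Derivation ℚ F F := fun n => Derivation.mk'
    { toFun := dt n
      map_add' := hadd n
      map_smul' := fun q x => by
        simp [Algebra.smul_def, hleib, hconst] }
    (fun x y => by
      simp only [LinearMap.coe_mk, AddHom.coe_mk, hleib, smul_eq_mul]
      ring)
  have hΦ_ord : OrdLE Φ 0 := fun k hk => by
    subst hΦ
    simp only
    rw [if_neg hk.ne', dif_neg hk.not_gt]
  let φ : PDO (E 1) := ⟨Φ, 0, hΦ_ord⟩
  let ψ : PDO (E 1) := ⟨Φinv, 0, hΦinvsupp⟩
  let d : PDO (E 1) := ⟨delta 1, 1, fun k hk => if_neg hk.ne'⟩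
  let L : PDO (E 1) := φ * d * ψ
  have hLn : (L ^ (i : ℕ)).1
      = ppow (dt 1) (pmul (dt 1) (pmul (dt 1) Φ (delta 1)) Φinv) (i : ℕ) := PDO.coe_pow L i
  let P : PDO (E 1) := ⟨pminus (L ^ (i : ℕ)).1, 0, fun k hk => if_neg hk.not_gt⟩
  let Q : PDO (E 1) := ⟨pplus (L ^ (i : ℕ)).1, by
    obtain ⟨a, ha⟩ := (L ^ (i : ℕ)).2
    refine ⟨a, fun k hk => ?_⟩
    rw [pplus, ha k hk, ite_self]⟩
  have hδ : ∀ x y : PDO (E 1), PDO.map (E i) (x * y)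
      = PDO.map (E i) x * y + x * PDO.map (E i) y := PDO.map_mul (hcomm i 1)
  have hδ₁ : PDO.map (E i) (1 : PDO (E 1)) = 0 :=
    Subtype.ext <| funext fun k => by
      change E i (pone k) = 0
      unfold pone
      split_ifs <;> simp
  have hd : PDO.map (E i) d = 0 :=
    Subtype.ext <| funext fun k => by
      change E i (delta 1 k) = 0
      unfold delta
      split_ifs <;> simp
  have hPQ : L ^ (i : ℕ) = P + Q :=
    Subtype.ext <| funext fun k => by
      change (L ^ (i : ℕ)).1 k = pminus (L ^ (i : ℕ)).1 k + pplus (L ^ (i : ℕ)).1 k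
      unfold pminus pplus
      rcases lt_or_ge k 0 with h | h
      · rw [if_pos h, if_neg h.not_ge, add_zero]
      · rw [if_neg h.not_gt, if_pos h, zero_add]
  have hSato' : PDO.map (E i) φ = -(P * φ) :=
    Subtype.ext <| funext fun k => by
      rw [← hLn] at hSato
      exact hSato k
  have h₁ : φ * ψ = 1 := Subtype.ext hinv₁
  have h₂ : ψ * φ = 1 := Subtype.ext hinv₂
  have hLax := lax_of_sato (PDO.map (E i)) hδ hδ₁ hd h₁ h₂ hPQ hSato'
  rw [← hLn]
  exact fun k => congrFun (congrArg Subtype.val hLax) k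

end
end
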